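/- arXiv:1711.08517 — 2 statements merged into one kernel-verified Lean document; each statement's English description precedes it below -/
import Mathlib

section
/- Suppose x_0⁽¹⁾ ≠ 0 and the gradient method is run for all k ≥ 0 with steps t_k > 0 satisfying both A(t_k) and W(t_k). Then the sequence (f(x_N))_{N≥0} is bounded below if and only if the sequence (x_N) converges to a point x̄ ∈ ℝⁿ with x̄⁽¹⁾ = 0. -/
/-- The index of the first coordinate of `ℝⁿ` (requires `n ≥ 2`). -/
def firstIdx {n : ℕ} (hn : 2 ≤ n) : Fin n := ⟨0, by omega⟩

/-- The objective function `f(x) = a|x⁽¹⁾| + ∑_{i=2}^n x⁽ⁱ⁾` on `ℝⁿ`. -/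
noncomputable def objF {n : ℕ} (hn : 2 ≤ n) (a : ℝ) (x : EuclideanSpace ℝ (Fin n)) : ℝ :=
  a * |x (firstIdx hn)| + ∑ i ∈ Finset.univ.erase (firstIdx hn), x i

/-- The gradient vector `∇f(x) = (sgn(x⁽¹⁾)·a, 1, …, 1)` of `f` at a point `x`
(meaningful when `x⁽¹⁾ ≠ 0`); here `Real.sign u = 1` if `u > 0` and `-1` if `u < 0`. -/
noncomputable def gradF {n : ℕ} (hn : 2 ≤ n) (a : ℝ) (x : EuclideanSpace ℝ (Fin n)) :
    EuclideanSpace ℝ (Fin n) :=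
  (EuclideanSpace.equiv (Fin n) ℝ).symm
    (fun i => if i = firstIdx hn then Real.sign (x (firstIdx hn)) * a else 1)

/-- The steepest-descent search direction `d = −∇f(x)`. -/
noncomputable def dir {n : ℕ} (hn : 2 ≤ n) (a : ℝ) (x : EuclideanSpace ℝ (Fin n)) :
    EuclideanSpace ℝ (Fin n) := -(gradF hn a x)

/-- The Armijo condition `A(t)`:
`f(x + t·d) ≤ f(x) − c₁·t·(a² + n − 1)` where `d = −∇f(x)`. -/
def armijo {n : ℕ} (hn : 2 ≤ n) (a c₁ : ℝ) (x : EuclideanSpace ℝ (Fin n)) (t : ℝ) : Prop :=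
  objF hn a (x + t • dir hn a x) ≤ objF hn a x - c₁ * t * (a ^ 2 + ((n : ℝ) - 1))

/-- The Wolfe condition `W(t)`: `f` is differentiable at `x + t·d` and
`⟨∇f(x + t·d), d⟩ ≥ −c₂·(a² + n − 1)` where `d = −∇f(x)`. -/
noncomputable def wolfe {n : ℕ} (hn : 2 ≤ n) (a c₂ : ℝ) (x : EuclideanSpace ℝ (Fin n))
    (t : ℝ) : Prop :=
  DifferentiableAt ℝ (objF hn a) (x + t • dir hn a x) ∧
    (inner ℝ (gradient (objF hn a) (x + t • dir hn a x)) (dir hn a x) : ℝ) ≥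
      -c₂ * (a ^ 2 + ((n : ℝ) - 1))

/-- `τ = c₁ + (n − 1)(c₁ − 1)/a²`. -/
noncomputable def tauP (n : ℕ) (a c₁ : ℝ) : ℝ := c₁ + ((n : ℝ) - 1) * (c₁ - 1) / a ^ 2

theorem dir_apply_first {n : ℕ} (hn : 2 ≤ n) (a : ℝ) (x : EuclideanSpace ℝ (Fin n)) :
    dir hn a x (firstIdx hn) = -(Real.sign (x (firstIdx hn)) * a) := by
  simp [dir, gradF]

theorem dir_apply_other {n : ℕ} (hn : 2 ≤ n) (a : ℝ) (x : EuclideanSpace ℝ (Fin n)) (i : Fin n)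
    (hi : i ≠ firstIdx hn) : dir hn a x i = -1 := by
  simp [dir, gradF, hi]

theorem sum_dir_other {n : ℕ} (hn : 2 ≤ n) (a : ℝ) (x : EuclideanSpace ℝ (Fin n)) :
    ∑ i ∈ Finset.univ.erase (firstIdx hn), dir hn a x i = -((n : ℝ) - 1) := by
  rw [Finset.sum_congr rfl (fun i hi => dir_apply_other hn a x i (Finset.ne_of_mem_erase hi))]
  rw [Finset.sum_const, Finset.card_erase_of_mem (Finset.mem_univ _), Finset.card_univ,
    Fintype.card_fin, nsmul_eq_mul, Nat.cast_sub (by omega)]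
  push_cast
  ring

theorem norm_dir_le {n : ℕ} (hn : 2 ≤ n) (a : ℝ) (x : EuclideanSpace ℝ (Fin n)) :
    ‖dir hn a x‖ ≤ Real.sqrt (∑ _i : Fin n, (a ^ 2 + 1)) := by
  rw [EuclideanSpace.norm_eq]
  apply Real.sqrt_le_sqrt
  apply Finset.sum_le_sum
  intro i _
  rw [Real.norm_eq_abs, sq_abs]
  by_cases hi : i = firstIdx hn
  · subst hi
    rw [dir_apply_first]
    rcases Real.sign_apply_eq (x (firstIdx hn)) with h | h | h <;> rw [h] <;> nlinarith [sq_nonneg a]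
  · rw [dir_apply_other hn a x i hi]
    nlinarith [sq_nonneg a]

theorem sign_change {n : ℕ} (hn : 2 ≤ n) (a c₂ : ℝ) (hc₂ : c₂ < 1)
    (x : EuclideanSpace ℝ (Fin n)) (t : ℝ) (hW : wolfe hn a c₂ x t) :
    x (firstIdx hn) * (x + t • dir hn a x) (firstIdx hn) ≤ 0 := by
  by_contra hcon
  push Not at hcon
  obtain ⟨hd, hi⟩ := hW
  set y := x + t • dir hn a x with hy
  set d := dir hn a x with hdd
  have h1 : HasDerivAt (fun s : ℝ => objF hn a (y + s • d)) (fderiv ℝ (objF hn a) y d) 0 :=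
    hd.hasFDerivAt.hasLineDerivAt d
  have hy0 : y (firstIdx hn) ≠ 0 := by
    intro h
    simp [h] at hcon
  have h2 : HasDerivAt (fun s : ℝ => objF hn a (y + s • d))
      (a * ((SignType.sign (y (firstIdx hn)) : ℝ) * d (firstIdx hn)) +
        ∑ i ∈ Finset.univ.erase (firstIdx hn), d i) 0 := by
    have hl : ∀ i, HasDerivAt (fun s : ℝ => (y + s • d) i) (d i) 0 := by
      intro i
      simpa using ((hasDerivAt_id (0 : ℝ)).mul_const (d i)).const_add (y i)
    have hb : HasDerivAt (fun u : ℝ => |u|) (SignType.sign (y (firstIdx hn)) : ℝ)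
        ((y + (0 : ℝ) • d) (firstIdx hn)) := by
      simpa using hasDerivAt_abs hy0
    exact ((hb.comp (0 : ℝ) (hl (firstIdx hn))).const_mul a).add
      (HasDerivAt.fun_sum fun i _ => hl i)
  have h3 := h1.unique h2
  have h4 : (inner ℝ (gradient (objF hn a) y) d : ℝ) = fderiv ℝ (objF hn a) y d := by
    simp [gradient]
  rw [h4, h3, sum_dir_other, hdd, dir_apply_first] at hi
  have hn' : (2 : ℝ) ≤ n := by exact_mod_cast hn
  have h5 : (SignType.sign (y (firstIdx hn)) : ℝ) * Real.sign (x (firstIdx hn)) = 1 := by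
    rcases lt_trichotomy (x (firstIdx hn)) 0 with h | h | h
    · have : y (firstIdx hn) < 0 := by
        by_contra h'
        push Not at h'
        nlinarith
      simp [sign_neg this, Real.sign_of_neg h]
    · simp [h] at hcon
    · have : 0 < y (firstIdx hn) := by
        by_contra h'
        push Not at h'
        nlinarith
      simp [sign_pos this, Real.sign_of_pos h]
  have h6 : a * ((SignType.sign (y (firstIdx hn)) : ℝ) *
      -(Real.sign (x (firstIdx hn)) * a)) = -a ^ 2 := by
    linear_combination (-a ^ 2) * h5
  rw [h6] at hi
  nlinarith [sq_nonneg a]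

/-- `(f(x_N))` is bounded below iff `(x_N)` converges to a point `x̄`
with `x̄⁽¹⁾ = 0`. -/
theorem stmt5 {n : ℕ} (hn : 2 ≤ n) (a c₁ c₂ : ℝ) (ha : Real.sqrt ((n : ℝ) - 1) ≤ a)
    (hc₁ : 0 < c₁) (hc₁₂ : c₁ < c₂) (hc₂ : c₂ < 1)
    (x : ℕ → EuclideanSpace ℝ (Fin n)) (t : ℕ → ℝ)
    (hx0 : x 0 (firstIdx hn) ≠ 0)
    (hstep : ∀ k, x (k + 1) = x k + t k • dir hn a (x k))
    (ht : ∀ k, 0 < t k)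
    (hA : ∀ k, armijo hn a c₁ (x k) (t k))
    (hW : ∀ k, wolfe hn a c₂ (x k) (t k)) :
    BddBelow (Set.range fun N => objF hn a (x N)) ↔
      ∃ xbar : EuclideanSpace ℝ (Fin n),
        Filter.Tendsto x Filter.atTop (nhds xbar) ∧ xbar (firstIdx hn) = 0 := by
  have hn' : (2 : ℝ) ≤ n := by exact_mod_cast hn
  have hK : 0 < a ^ 2 + ((n : ℝ) - 1) := by nlinarith [sq_nonneg a]
  constructor
  · rintro ⟨m, hm⟩
    have hsum : ∀ N, objF hn a (x N) ≤ objF hn a (x 0) -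
        c₁ * (a ^ 2 + ((n : ℝ) - 1)) * ∑ k ∈ Finset.range N, t k := by
      intro N
      induction N with
      | zero => simp
      | succ N ih =>
        have h := hA N
        unfold armijo at h
        rw [← hstep N] at h
        rw [Finset.sum_range_succ]
        nlinarith
    have hs : Summable t := by
      apply summable_of_sum_range_le (c := (objF hn a (x 0) - m) / (c₁ * (a ^ 2 + ((n : ℝ) - 1))))
        (fun k => (ht k).le)
      intro N
      rw [le_div_iff₀ (by positivity)]
      have := hm (Set.mem_range_self N)
      have := hsum N
      simp only at *
      nlinarith
    have hc : CauchySeq x := by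
      apply cauchySeq_of_dist_le_of_summable _ _
        (hs.mul_right (Real.sqrt (∑ _i : Fin n, (a ^ 2 + 1))))
      intro k
      rw [Nat.succ_eq_add_one, hstep k, dist_self_add_right, norm_smul, Real.norm_eq_abs,
        abs_of_pos (ht k)]
      exact mul_le_mul_of_nonneg_left (norm_dir_le hn a (x k)) (ht k).le
    obtain ⟨xbar, hx⟩ := cauchySeq_tendsto_of_complete hc
    refine ⟨xbar, hx, ?_⟩
    have h1 : Filter.Tendsto (fun k => x k (firstIdx hn)) Filter.atTop
        (nhds (xbar (firstIdx hn))) :=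
      ((EuclideanSpace.proj (𝕜 := ℝ) (firstIdx hn)).continuous.tendsto xbar).comp hx
    have h2 := h1.mul (h1.comp (Filter.tendsto_add_atTop_nat 1))
    have h3 : xbar (firstIdx hn) * xbar (firstIdx hn) ≤ 0 := by
      apply le_of_tendsto' h2
      intro k
      have := sign_change hn a c₂ hc₂ (x k) (t k) (hW k)
      rw [← hstep k] at this
      exact this
    exact mul_self_eq_zero.mp (le_antisymm h3 (mul_self_nonneg _))
  · rintro ⟨xbar, hx, -⟩
    have hf : Continuous (objF hn a) := by
      unfold objF
      fun_prop
    exact ((hf.tendsto xbar).comp hx).bddBelow_range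
end

section
/- Let x ∈ ℝⁿ with x⁽¹⁾ ≠ 0 and let d = −(sgn(x⁽¹⁾)·a, 1, …, 1) be the negative gradient direction of f at x. Then the function t ↦ f(x + t·d) is bounded below on [0, ∞) if and only if a² ≥ n − 1. -/
/-- Explicit value of the objective along the steepest-descent ray. -/
theorem objF_ray {n : ℕ} (hn : 2 ≤ n) (a : ℝ)
    (x : EuclideanSpace ℝ (Fin n)) (hx : x (firstIdx hn) ≠ 0) (t : ℝ) :
    objF hn a (x + t • dir hn a x) =
      a * abs (|x (firstIdx hn)| - t * a) +
        ((∑ i ∈ Finset.univ.erase (firstIdx hn), x i) - t * ((n : ℝ) - 1)) := by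
  have h1 : (x + t • dir hn a x) (firstIdx hn) =
      x (firstIdx hn) - t * (Real.sign (x (firstIdx hn)) * a) := by
    simp [dir, gradF]
    ring
  have h2 : ∀ i ∈ Finset.univ.erase (firstIdx hn), (x + t • dir hn a x) i = x i - t := by
    intro i hi
    have hi' : i ≠ firstIdx hn := Finset.ne_of_mem_erase hi
    simp [dir, gradF, hi']
    ring
  unfold objF
  rw [Finset.sum_congr rfl h2, h1, Finset.sum_sub_distrib, Finset.sum_const,
    Finset.card_erase_of_mem (Finset.mem_univ _), Finset.card_univ, Fintype.card_fin,
    nsmul_eq_mul, Nat.cast_sub (by omega : 1 ≤ n), Nat.cast_one]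
  have h3 : |x (firstIdx hn) - t * (Real.sign (x (firstIdx hn)) * a)| =
      abs (|x (firstIdx hn)| - t * a) := by
    rcases lt_or_gt_of_ne hx with h | h
    · rw [Real.sign_of_neg h, abs_of_neg h, ← abs_neg]
      congr 1
      ring
    · rw [Real.sign_of_pos h, abs_of_pos h, one_mul]
  rw [h3]
  ring

/-- for `a > 0` (not necessarily `a ≥ √(n−1)`) and `x` with `x⁽¹⁾ ≠ 0`,
the function `t ↦ f(x + t·d)` with `d = −∇f(x) = −(sgn(x⁽¹⁾)·a, 1, …, 1)` is bounded
below on `[0, ∞)` iff `a² ≥ n − 1`. -/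
theorem stmt19 {n : ℕ} (hn : 2 ≤ n) (a : ℝ) (ha : 0 < a)
    (x : EuclideanSpace ℝ (Fin n)) (hx : x (firstIdx hn) ≠ 0) :
    BddBelow ((fun t : ℝ => objF hn a (x + t • dir hn a x)) '' Set.Ici 0) ↔
      (n : ℝ) - 1 ≤ a ^ 2 := by
  have key := objF_ray hn a x hx
  set S := ∑ i ∈ Finset.univ.erase (firstIdx hn), x i
  set u := |x (firstIdx hn)|
  have hu : 0 ≤ u := abs_nonneg _
  constructor
  · rintro ⟨m, hm⟩
    by_contra! hlt
    have hb : ∀ t : ℝ, 0 ≤ t → m ≤ a * |u - t * a| + (S - t * ((n : ℝ) - 1)) := by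
      intro t ht
      rw [← key t]
      exact hm ⟨t, ht, rfl⟩
    have hδ : 0 < (n : ℝ) - 1 - a ^ 2 := by linarith
    have hc : 0 ≤ (|S - m| + a * u + 1) / ((n : ℝ) - 1 - a ^ 2) := by positivity
    have h := hb _ hc
    set t := (|S - m| + a * u + 1) / ((n : ℝ) - 1 - a ^ 2) with ht
    have hte : t * ((n : ℝ) - 1 - a ^ 2) = |S - m| + a * u + 1 :=
      div_mul_cancel₀ _ hδ.ne'
    have habs : |u - t * a| ≤ u + t * a := by
      have : 0 ≤ t * a := by positivity
      rw [abs_le]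
      constructor <;> linarith
    have h4 := mul_le_mul_of_nonneg_left habs ha.le
    have h5 := le_abs_self (S - m)
    nlinarith
  · intro h
    refine ⟨S - a * u, ?_⟩
    rintro _ ⟨t, ht, rfl⟩
    have ht' : 0 ≤ t := ht
    simp only [key t]
    have h4 := mul_le_mul_of_nonneg_left (neg_abs_le (u - t * a)) ha.le
    have h5 := mul_le_mul_of_nonneg_left h ht'
    nlinarith
end
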